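/- Let ε > 0 and let n be an integer with εn ≥ 3. Let H be a 3-uniform hypergraph on n vertices with δ₂(H) ≥ (1/3 + ε)n containing no homomorphic copy of the tight cycle C₁₁. Then every vertex v of H with d_B(v) > 0 satisfies d_D⁺(v) ≥ (1/3 + ε)n, where d_B(v) is the degree of v in the base-pair graph B and d_D⁺(v) is the out-degree of v in the apex digraph D. -/

import Mathlib

open Finset

/-- A 3-uniform hypergraph given by its edge set: every edge has exactly 3 vertices. -/
def IsUniform3 {V : Type*} (H : Finset (Finset V)) : Prop :=
  ∀ e ∈ H, e.card = 3

/-- The codegree of a pair of vertices: the number of vertices `w` with `{u,v,w} ∈ H`. -/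
noncomputable def codeg {V : Type*} [DecidableEq V] (H : Finset (Finset V)) (u v : V) : ℕ :=
  {w : V | ({u, v, w} : Finset V) ∈ H}.ncard

/-- The minimum codegree `δ₂(H)`: the minimum of `codeg H u v` over pairs of distinct vertices. -/
noncomputable def minCodeg {V : Type*} [DecidableEq V] (H : Finset (Finset V)) : ℕ :=
  sInf {d : ℕ | ∃ u v : V, u ≠ v ∧ codeg H u v = d}

/-- `H` contains a homomorphic copy of the tight cycle `C_ℓ`: a cyclic sequence of vertices
(indexed by `ZMod ℓ`, not necessarily distinct) in which every three cyclically consecutive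
vertices are pairwise distinct and form an edge of `H`. -/
def HasHomTightCycle {V : Type*} [DecidableEq V] (ℓ : ℕ) (H : Finset (Finset V)) : Prop :=
  ∃ x : ZMod ℓ → V, ∀ i : ZMod ℓ,
    x (i - 1) ≠ x i ∧ x i ≠ x (i + 1) ∧ x (i - 1) ≠ x (i + 1) ∧
      ({x (i - 1), x i, x (i + 1)} : Finset V) ∈ H

/-- `H` contains a (genuine) copy of the tight cycle `C_ℓ`: `ℓ` distinct vertices, cyclically
ordered, such that every three cyclically consecutive vertices form an edge of `H`. -/
def HasTightCycle {V : Type*} [DecidableEq V] (ℓ : ℕ) (H : Finset (Finset V)) : Prop :=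
  ∃ x : ZMod ℓ → V, Function.Injective x ∧
    ∀ i : ZMod ℓ, ({x (i - 1), x i, x (i + 1)} : Finset V) ∈ H

/-- The arc `u → v` of the apex digraph `D`: some `K₄⁻` of `H` contains `u` and `v`
with apex `v`; i.e. there are two further vertices `a, b` (with `u,v,a,b` distinct)
such that the three edges through `v` on `{u,v,a,b}` all lie in `H`. -/
def ArcD {V : Type*} [DecidableEq V] (H : Finset (Finset V)) (u v : V) : Prop :=
  ∃ a b : V, ({u, v, a, b} : Finset V).card = 4 ∧
    ({v, u, a} : Finset V) ∈ H ∧ ({v, u, b} : Finset V) ∈ H ∧ ({v, a, b} : Finset V) ∈ H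

/-- `{u,v}` is a base pair: some `K₄⁻` of `H` contains `u` and `v` with neither `u` nor
`v` being the apex; i.e. there are further vertices `w, a` (with `u,v,w,a` distinct) with
apex `w`, so that the three edges through `w` on `{u,v,w,a}` all lie in `H`. -/
def BasePair {V : Type*} [DecidableEq V] (H : Finset (Finset V)) (u v : V) : Prop :=
  ∃ w a : V, ({u, v, w, a} : Finset V).card = 4 ∧
    ({w, u, v} : Finset V) ∈ H ∧ ({w, u, a} : Finset V) ∈ H ∧ ({w, v, a} : Finset V) ∈ H

/-- The degree of `v` in the base-pair graph `B`. -/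
noncomputable def degB {V : Type*} [DecidableEq V] (H : Finset (Finset V)) (v : V) : ℕ :=
  {u : V | BasePair H u v}.ncard

/-- The out-degree of `v` in the apex digraph `D`. -/
noncomputable def outDegD {V : Type*} [DecidableEq V] (H : Finset (Finset V)) (v : V) : ℕ :=
  {u : V | ArcD H v u}.ncard

/-- The in-degree of `v` in the apex digraph `D`. -/
noncomputable def inDegD {V : Type*} [DecidableEq V] (H : Finset (Finset V)) (v : V) : ℕ :=
  {u : V | ArcD H u v}.ncard

/-- The codegree Turán number `ex₂(n, C_ℓ)`: the maximum of `δ₂(H)` over all 3-uniform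
hypergraphs `H` on `n` vertices containing no copy of the tight cycle `C_ℓ`. -/
noncomputable def exCodeg (ℓ n : ℕ) : ℕ :=
  sSup {k : ℕ | ∃ H : Finset (Finset (Fin n)),
    IsUniform3 H ∧ ¬ HasTightCycle ℓ H ∧ minCodeg H = k}

theorem IsUniform3.pairwise_ne {V : Type*} [DecidableEq V] {H : Finset (Finset V)}
    (hH : IsUniform3 H) {a b c : V} (h : ({a, b, c} : Finset V) ∈ H) :
    a ≠ b ∧ a ≠ c ∧ b ≠ c := by
  have h3 := hH _ h
  grind [Finset.card_le_two]

/-- Two copies of `K₄⁻`, one with apex `w` and base `{u, v, a}` and one with apex `u` and base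
`{v, x, y}`, together contain a homomorphic copy of `C₁₁`. -/
theorem hasHomTightCycle_eleven {V : Type*} [DecidableEq V] {H : Finset (Finset V)}
    (hH : IsUniform3 H) {u v w a x y : V}
    (huv : ({w, u, v} : Finset V) ∈ H) (hua : ({w, u, a} : Finset V) ∈ H)
    (hva : ({w, v, a} : Finset V) ∈ H) (hx : ({u, v, x} : Finset V) ∈ H)
    (hy : ({u, v, y} : Finset V) ∈ H) (hxy : ({u, x, y} : Finset V) ∈ H) :
    HasHomTightCycle 11 H := by
  let f : ZMod 11 → V := (![w, u, v, x, u, y, v, u, w, v, a] : Fin 11 → V)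
  have key : ∀ i : ZMod 11, ({f (i - 1), f i, f (i + 1)} : Finset V) ∈ H := by
    intro i
    have perm : ∀ {p q r p' q' r' : V}, ({p, q, r} : Finset V) ∈ H →
        ({p', q', r'} : Finset V) = {p, q, r} → ({p', q', r'} : Finset V) ∈ H :=
      fun h e => e ▸ h
    fin_cases i
    · exact perm (p' := a) (q' := w) (r' := u) hua (by grind)
    · exact perm (p' := w) (q' := u) (r' := v) huv rfl
    · exact perm (p' := u) (q' := v) (r' := x) hx rfl
    · exact perm (p' := v) (q' := x) (r' := u) hx (by grind)
    · exact perm (p' := x) (q' := u) (r' := y) hxy (by grind)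
    · exact perm (p' := u) (q' := y) (r' := v) hy (by grind)
    · exact perm (p' := y) (q' := v) (r' := u) hy (by grind)
    · exact perm (p' := v) (q' := u) (r' := w) huv (by grind)
    · exact perm (p' := u) (q' := w) (r' := v) huv (by grind)
    · exact perm (p' := w) (q' := v) (r' := a) hva rfl
    · exact perm (p' := v) (q' := a) (r' := w) hva (by grind)
  refine ⟨f, fun i => ?_⟩
  obtain ⟨h₁, h₂, h₃⟩ := hH.pairwise_ne (key i)
  exact ⟨h₁, h₃, h₂, key i⟩

theorem minCodeg_le_codeg {V : Type*} [DecidableEq V] (H : Finset (Finset V)) {u v : V}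
    (huv : u ≠ v) : minCodeg H ≤ codeg H u v :=
  Nat.sInf_le ⟨u, v, huv, rfl⟩

/-- Among three sets whose sizes add up to more than that of the ground set, two intersect. -/
theorem exists_mem_two_of_card_lt_ncard_add {V : Type*} [Fintype V] {A B C : Set V}
    (h : Fintype.card V < A.ncard + B.ncard + C.ncard) :
    ∃ y, y ∈ A ∧ y ∈ B ∨ y ∈ A ∧ y ∈ C ∨ y ∈ B ∧ y ∈ C := by
  by_contra! hne
  have hAB : Disjoint A B := Set.disjoint_left.mpr fun y => (hne y).1
  have hABC : Disjoint (A ∪ B) C := Set.disjoint_left.mpr fun y hy =>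
    hy.elim (hne y).2.1 (hne y).2.2
  have hle := Set.ncard_le_ncard (Set.subset_univ (A ∪ B ∪ C))
  rw [Set.ncard_union_eq hABC, Set.ncard_union_eq hAB, Set.ncard_univ,
    Nat.card_eq_fintype_card] at hle
  lia

/-- If `ε > 0`, `εn ≥ 3` and `H` is a 3-uniform hypergraph on `n` vertices with
`δ₂(H) ≥ (1/3 + ε)n` and no homomorphic copy of `C₁₁`, then every vertex `v` with
`d_B(v) > 0` satisfies `d_D⁺(v) ≥ (1/3 + ε)n`. -/
theorem degB_pos_imp_outDegD_large {n : ℕ} (ε : ℝ) (hε : 0 < ε) (hεn : (3 : ℝ) ≤ ε * n)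
    (H : Finset (Finset (Fin n))) (hH : IsUniform3 H)
    (hδ : ((1 / 3 : ℝ) + ε) * n ≤ (minCodeg H : ℝ))
    (hfree : ¬ HasHomTightCycle 11 H) :
    ∀ v : Fin n, 0 < degB H v → ((1 / 3 : ℝ) + ε) * n ≤ (outDegD H v : ℝ) := by
  intro v hv
  obtain ⟨u, w, a, -, huv, hua, hva⟩ := Set.nonempty_of_ncard_ne_zero hv.ne'
  have hne : u ≠ v := (hH.pairwise_ne huv).2.2
  have hsub : {x | ({u, v, x} : Finset (Fin n)) ∈ H} ⊆ {x | ArcD H v x} := by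
    intro x (hx : ({u, v, x} : Finset (Fin n)) ∈ H)
    obtain ⟨-, hux, hvx⟩ := hH.pairwise_ne hx
    have hn : 0 < (n : ℝ) := by exact_mod_cast v.pos
    have hsum : n < 3 * minCodeg H := by
      have : (n : ℝ) < 3 * minCodeg H := by nlinarith
      exact_mod_cast this
    obtain ⟨y, hy⟩ := exists_mem_two_of_card_lt_ncard_add
      (A := {y | ({u, v, y} : Finset (Fin n)) ∈ H})
      (B := {y | ({u, x, y} : Finset (Fin n)) ∈ H})
      (C := {y | ({v, x, y} : Finset (Fin n)) ∈ H}) (by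
        have h₁ := minCodeg_le_codeg H hne
        have h₂ := minCodeg_le_codeg H hux
        have h₃ := minCodeg_le_codeg H hvx
        unfold codeg at h₁ h₂ h₃
        rw [Fintype.card_fin]
        lia)
    simp only [Set.mem_ofPred_eq] at hy
    rcases hy with ⟨hy, hxy⟩ | ⟨hy, hxy⟩ | ⟨hxu, hxv⟩
    · exact (hfree (hasHomTightCycle_eleven hH huv hua hva hx hy hxy)).elim
    · refine (hfree (hasHomTightCycle_eleven hH (u := v) (v := u) (x := x) (y := y) ?_ hva hua
        ?_ ?_ hxy)).elim
      · rwa [Finset.pair_comm]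
      · rwa [Finset.insert_comm]
      · rwa [Finset.insert_comm]
    · obtain ⟨-, huy, hxy⟩ := hH.pairwise_ne hxu
      obtain ⟨-, hvy, -⟩ := hH.pairwise_ne hxv
      refine ⟨u, y, ?_, ?_, ?_, ?_⟩
      · grind
      · convert hx using 1
        grind
      · rwa [Finset.insert_comm]
      · rwa [Finset.insert_comm]
  refine hδ.trans ?_
  exact_mod_cast (minCodeg_le_codeg H hne).trans (Set.ncard_le_ncard hsub)
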